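/- arXiv:1010.3433 — 2 statements merged into one kernel-verified Lean document; each statement's English description precedes it below -/
import Mathlib

section
/- For all b > 1, all x, y > 0, all real t ≠ 0 and either choice of sign ±, one has |∫_1^b (λ/((λ²−1)^{1/2} + λ)) e^{i(λ²−1)^{1/2} x} e^{iλy} e^{±itλ²} dλ| ≤ 15 |t|^{−1/2}. -/
open MeasureTheory Complex

/-- **First derivative test** for an oscillatory integral with a nonincreasing amplitude
`a ∈ [0, 1]`; the function `G` controls the total variation of the reciprocal of the phase derivative. -/
theorem norm_integral_mul_exp_le_of_le_abs_deriv {a a' φ φ' φ'' G H : ℝ → ℝ} {c d m : ℝ}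
    (hcd : c ≤ d) (hm : 0 < m)
    (ha : ∀ l ∈ Set.Icc c d, HasDerivAt a (a' l) l)
    (ha0 : ∀ l ∈ Set.Icc c d, 0 ≤ a l) (ha1 : ∀ l ∈ Set.Icc c d, a l ≤ 1)
    (ha' : ∀ l ∈ Set.Icc c d, a' l ≤ 0)
    (hφ : ∀ l ∈ Set.Icc c d, HasDerivAt φ (φ' l) l)
    (hφ' : ∀ l ∈ Set.Icc c d, HasDerivAt φ' (φ'' l) l)
    (hmφ : ∀ l ∈ Set.Icc c d, m ≤ |φ' l|)
    (hG : ∀ l ∈ Set.Icc c d, HasDerivAt G (H l) l)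
    (hH : ∀ l ∈ Set.Icc c d, |φ'' l| / φ' l ^ 2 ≤ H l) :
    ‖∫ l in c..d, (a l : ℂ) * exp (φ l * I)‖ ≤ 3 / m + (G d - G c) := by
  set f : ℝ → ℂ := fun l => (a l : ℂ) * exp (φ l * I) with hf
  set F : ℝ → ℂ := fun l => ((a l / φ' l : ℝ) : ℂ) * exp (φ l * I) * (-I) with hF
  have hne : ∀ l ∈ Set.Icc c d, φ' l ≠ 0 := fun l hl h0 => by
    have := hmφ l hl
    rw [h0, abs_zero] at this
    linarith
  have hexp : ∀ l ∈ Set.Icc c d,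
      HasDerivAt (fun l => exp (φ l * I)) (exp (φ l * I) * ((φ' l : ℂ) * I)) l := fun l hl =>
    ((hφ l hl).ofReal_comp.mul_const I).cexp
  have hfc : ContinuousOn f (Set.Icc c d) := fun l hl =>
    ((ha l hl).ofReal_comp.continuousAt.mul (hexp l hl).continuousAt).continuousWithinAt
  set R : ℝ → ℂ := fun l =>
    (((a' l * φ' l - a l * φ'' l) / φ' l ^ 2 : ℝ) : ℂ) * exp (φ l * I) * (-I) with hR
  have hFd : ∀ l ∈ Set.Icc c d, HasDerivAt F (f l + R l) l := fun l hl => by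
    have h := ((((ha l hl).div (hφ' l hl) (hne l hl)).ofReal_comp.mul (hexp l hl)).mul_const (-I))
    refine h.congr_deriv ?_
    have h1 : (φ' l : ℂ) ≠ 0 := by exact_mod_cast hne l hl
    simp only [hf, hR, Pi.div_apply]
    push_cast
    field_simp
    linear_combination (-(a l : ℂ) * φ' l ^ 2) * I_sq
  have hFn : ∀ l ∈ Set.Icc c d, ‖F l‖ ≤ 1 / m := fun l hl => by
    simp only [hF, norm_mul, norm_exp_ofReal_mul_I, norm_neg, norm_I, mul_one, norm_real,
      Real.norm_eq_abs, abs_div, abs_of_nonneg (ha0 l hl)]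
    exact div_le_div₀ zero_le_one (ha1 l hl) hm (hmφ l hl)
  have hRn : ∀ l ∈ Set.Icc c d, ‖R l‖ ≤ -a' l / m + H l := fun l hl => by
    have hp : 0 < |φ' l| := hm.trans_le (hmφ l hl)
    simp only [hR, norm_mul, norm_exp_ofReal_mul_I, norm_neg, norm_I, mul_one, norm_real,
      Real.norm_eq_abs]
    have h1 : (a' l * φ' l - a l * φ'' l) / φ' l ^ 2
        = a' l / φ' l - a l * (φ'' l / φ' l ^ 2) := by
      have := hne l hl
      field_simp
    rw [h1]
    refine (abs_sub _ _).trans (add_le_add ?_ ?_)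
    · rw [abs_div, abs_of_nonpos (ha' l hl)]
      exact div_le_div_of_nonneg_left (by linarith [ha' l hl]) hm (hmφ l hl)
    · rw [abs_mul, abs_div, abs_of_nonneg (ha0 l hl), abs_of_nonneg (sq_nonneg (φ' l))]
      exact (mul_le_of_le_one_left (by positivity) (ha1 l hl)).trans (hH l hl)
  have hJ : ∀ l ∈ Set.Icc c d,
      HasDerivWithinAt (fun u => ∫ l in c..u, f l) (f l) (Set.Icc c d) l := fun l hl => by
    have : Fact (l ∈ Set.Icc c d) := ⟨hl⟩
    refine intervalIntegral.integral_hasDerivWithinAt_right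
      ((hfc.mono (Set.Icc_subset_Icc_right hl.2)).intervalIntegrable_of_Icc hl.1)
      (hfc.stronglyMeasurableAtFilter_nhdsWithin measurableSet_Icc l) (hfc l hl)
  have hK : ∀ l ∈ Set.Icc c d, HasDerivWithinAt (fun u => (∫ l in c..u, f l) - (F u - F c))
      (-R l) (Set.Icc c d) l := fun l hl =>
    ((hJ l hl).sub ((hFd l hl).hasDerivWithinAt.sub_const _)).congr_deriv (by ring)
  have hB : ∀ l ∈ Set.Icc c d, HasDerivAt (fun u => (a c - a u) / m + (G u - G c))
      (-a' l / m + H l) l := fun l hl =>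
    (((ha l hl).const_sub _).div_const m).add ((hG l hl).sub_const _)
  have key := image_norm_le_of_norm_deriv_right_le_deriv_boundary'
    (fun l hl => (hK l hl).continuousWithinAt)
    (fun l hl => (hK l (Set.Ico_subset_Icc_self hl)).mono_of_mem_nhdsWithin
      (Icc_mem_nhdsGE_of_mem hl))
    (by simp) (fun l hl => (hB l hl).continuousAt.continuousWithinAt)
    (fun l hl => (hB l (Set.Ico_subset_Icc_self hl)).hasDerivWithinAt)
    (fun l hl => by rw [norm_neg]; exact hRn l (Set.Ico_subset_Icc_self hl))
    (Set.right_mem_Icc.2 hcd)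
  have hc := Set.left_mem_Icc.2 hcd
  have hd := Set.right_mem_Icc.2 hcd
  have ha2 : (a c - a d) / m ≤ 1 / m := by
    gcongr
    linarith [ha1 c hc, ha0 d hd]
  have h3 : (3 : ℝ) / m = 1 / m + 1 / m + 1 / m := by ring
  calc ‖∫ l in c..d, f l‖
      = ‖((∫ l in c..d, f l) - (F d - F c)) + (F d - F c)‖ := by rw [sub_add_cancel]
    _ ≤ ((a c - a d) / m + (G d - G c)) + (‖F d‖ + ‖F c‖) :=
        (norm_add_le _ _).trans (add_le_add key (norm_sub_le _ _))
    _ ≤ 3 / m + (G d - G c) := by linarith [hFn c hc, hFn d hd]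

/-- The first derivative test for a concave phase. -/
theorem norm_integral_mul_exp_le_of_concave {a a' φ φ' φ'' : ℝ → ℝ} {c d m : ℝ}
    (hcd : c ≤ d) (hm : 0 < m)
    (ha : ∀ l ∈ Set.Icc c d, HasDerivAt a (a' l) l)
    (ha0 : ∀ l ∈ Set.Icc c d, 0 ≤ a l) (ha1 : ∀ l ∈ Set.Icc c d, a l ≤ 1)
    (ha' : ∀ l ∈ Set.Icc c d, a' l ≤ 0)
    (hφ : ∀ l ∈ Set.Icc c d, HasDerivAt φ (φ' l) l)
    (hφ' : ∀ l ∈ Set.Icc c d, HasDerivAt φ' (φ'' l) l)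
    (hφ'' : ∀ l ∈ Set.Icc c d, φ'' l ≤ 0)
    (hmφ : ∀ l ∈ Set.Icc c d, m ≤ |φ' l|) :
    ‖∫ l in c..d, (a l : ℂ) * exp (φ l * I)‖ ≤ 5 / m := by
  have hinv : ∀ l ∈ Set.Icc c d, |(φ' l)⁻¹| ≤ 1 / m := fun l hl => by
    rw [abs_inv, ← one_div]
    exact one_div_le_one_div_of_le hm (hmφ l hl)
  have h := norm_integral_mul_exp_le_of_le_abs_deriv (G := fun l => (φ' l)⁻¹)
    (H := fun l => -φ'' l / φ' l ^ 2) hcd hm ha ha0 ha1 ha' hφ hφ' hmφ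
    (fun l hl => (hφ' l hl).inv (abs_pos.1 (hm.trans_le (hmφ l hl))))
    (fun l hl => by rw [abs_of_nonpos (hφ'' l hl)])
  have hc := abs_le.1 (hinv c (Set.left_mem_Icc.2 hcd))
  have hd := abs_le.1 (hinv d (Set.right_mem_Icc.2 hcd))
  have h5 : 5 / m = 3 / m + 1 / m + 1 / m := by ring
  linarith [hc.1, hd.2]

theorem norm_mul_exp_le_one {u v : ℝ} (h0 : 0 ≤ u) (h1 : u ≤ 1) :
    ‖(u : ℂ) * exp (v * I)‖ ≤ 1 := by
  rwa [norm_mul, norm_exp_ofReal_mul_I, mul_one, norm_real, Real.norm_of_nonneg h0]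

/-- **Second derivative test** (van der Corput) for a concave phase. -/
theorem norm_integral_mul_exp_le_of_second_deriv_le {a a' φ φ' φ'' : ℝ → ℝ} {c d r : ℝ}
    (hcd : c ≤ d) (hr : 0 < r)
    (ha : ∀ l ∈ Set.Icc c d, HasDerivAt a (a' l) l)
    (ha0 : ∀ l ∈ Set.Icc c d, 0 ≤ a l) (ha1 : ∀ l ∈ Set.Icc c d, a l ≤ 1)
    (ha' : ∀ l ∈ Set.Icc c d, a' l ≤ 0)
    (hφ : ∀ l ∈ Set.Icc c d, HasDerivAt φ (φ' l) l)
    (hφ' : ∀ l ∈ Set.Icc c d, HasDerivAt φ' (φ'' l) l)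
    (hφ'' : ∀ l ∈ Set.Icc c d, φ'' l ≤ -r) :
    ‖∫ l in c..d, (a l : ℂ) * exp (φ l * I)‖ ≤ 12 / √r := by
  have hs : 0 < √r := Real.sqrt_pos.2 hr
  have hss : √r * √r = r := Real.mul_self_sqrt hr.le
  have hcont : ContinuousOn φ' (Set.Icc c d) := fun l hl =>
    (hφ' l hl).continuousAt.continuousWithinAt
  have hanti : AntitoneOn (fun l => φ' l + r * l) (Set.Icc c d) := by
    refine antitoneOn_of_hasDerivWithinAt_nonpos (f' := fun l => φ'' l + r * 1) (convex_Icc c d)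
      (hcont.add (by fun_prop)) (fun l hl => ?_) (fun l hl => ?_)
    · have hl := interior_subset hl
      exact ((hφ' l hl).add ((hasDerivAt_id l).const_mul r)).hasDerivWithinAt
    · linarith [hφ'' l (interior_subset hl)]
  obtain ⟨z, hz, hzl, hzr⟩ : ∃ z ∈ Set.Icc c d, (c < z → 0 ≤ φ' z) ∧ (z < d → φ' z ≤ 0) := by
    by_cases h1 : 0 ≤ φ' d
    · exact ⟨d, Set.right_mem_Icc.2 hcd, fun _ => h1, fun h => absurd h (lt_irrefl d)⟩
    by_cases h2 : φ' c ≤ 0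
    · exact ⟨c, Set.left_mem_Icc.2 hcd, fun h => absurd h (lt_irrefl c), fun _ => h2⟩
    push Not at h1 h2
    obtain ⟨z, hz, h0⟩ := intermediate_value_Icc' hcd hcont ⟨h1.le, h2.le⟩
    exact ⟨z, hz, fun _ => h0.ge, fun _ => h0.le⟩
  set p := max c (z - 1 / √r)
  set q := min d (z + 1 / √r)
  have hδ : 0 < 1 / √r := by positivity
  have hrδ : r * (1 / √r) = √r := by
    field_simp
    linarith
  have hcp : c ≤ p := le_max_left _ _
  have hpz : p ≤ z := max_le hz.1 (by linarith)
  have hzq : z ≤ q := le_min hz.2 (by linarith)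
  have hqd : q ≤ d := min_le_left _ _
  have hfc : ContinuousOn (fun l => (a l : ℂ) * exp (φ l * I)) (Set.Icc c d) := fun l hl =>
    ((ha l hl).ofReal_comp.continuousAt.mul
      ((hφ l hl).ofReal_comp.mul_const I).cexp.continuousAt).continuousWithinAt
  have hint : ∀ u v, c ≤ u → u ≤ v → v ≤ d →
      IntervalIntegrable (fun l => (a l : ℂ) * exp (φ l * I)) volume u v := fun u v h1 h2 h3 =>
    (hfc.mono (Set.Icc_subset_Icc h1 h3)).intervalIntegrable_of_Icc h2
  have hleft : ‖∫ l in c..p, (a l : ℂ) * exp (φ l * I)‖ ≤ 5 / √r := by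
    rcases hcp.eq_or_lt with h | h
    · rw [← h, intervalIntegral.integral_same, norm_zero]
      positivity
    have hp : p = z - 1 / √r := by
      rcases max_choice c (z - 1 / √r) with h' | h'
      · exact absurd h' h.ne'
      · exact h'
    have hsub : Set.Icc c p ⊆ Set.Icc c d := Set.Icc_subset_Icc_right (by linarith)
    refine norm_integral_mul_exp_le_of_concave hcp hs (fun l hl => ha l (hsub hl))
      (fun l hl => ha0 l (hsub hl)) (fun l hl => ha1 l (hsub hl)) (fun l hl => ha' l (hsub hl))
      (fun l hl => hφ l (hsub hl)) (fun l hl => hφ' l (hsub hl))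
      (fun l hl => by linarith [hφ'' l (hsub hl)]) (fun l hl => le_abs.2 (Or.inl ?_))
    have h1 := hanti (hsub hl) hz (by linarith [hl.2])
    have h2 := hzl (by linarith)
    have h3 : r * (1 / √r) ≤ r * (z - l) :=
      mul_le_mul_of_nonneg_left (by linarith [hl.2]) hr.le
    simp only at h1
    linarith
  have hright : ‖∫ l in q..d, (a l : ℂ) * exp (φ l * I)‖ ≤ 5 / √r := by
    rcases hqd.eq_or_lt with h | h
    · rw [h, intervalIntegral.integral_same, norm_zero]
      positivity
    have hq : q = z + 1 / √r := by
      rcases min_choice d (z + 1 / √r) with h' | h'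
      · exact absurd h' h.ne
      · exact h'
    have hsub : Set.Icc q d ⊆ Set.Icc c d := Set.Icc_subset_Icc_left (by linarith)
    refine norm_integral_mul_exp_le_of_concave hqd hs (fun l hl => ha l (hsub hl))
      (fun l hl => ha0 l (hsub hl)) (fun l hl => ha1 l (hsub hl)) (fun l hl => ha' l (hsub hl))
      (fun l hl => hφ l (hsub hl)) (fun l hl => hφ' l (hsub hl))
      (fun l hl => by linarith [hφ'' l (hsub hl)]) (fun l hl => le_abs.2 (Or.inr ?_))
    have h1 := hanti hz (hsub hl) (by linarith [hl.1])
    have h2 := hzr (by linarith)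
    have h3 : r * (1 / √r) ≤ r * (l - z) :=
      mul_le_mul_of_nonneg_left (by linarith [hl.1]) hr.le
    simp only at h1
    linarith
  have hmid : ‖∫ l in p..q, (a l : ℂ) * exp (φ l * I)‖ ≤ 2 / √r := by
    have hpq : p ≤ q := hpz.trans hzq
    have h := intervalIntegral.norm_integral_le_of_norm_le_const
      (a := p) (b := q) (C := 1) (f := fun l => (a l : ℂ) * exp (φ l * I)) (fun l hl => by
        rw [Set.uIoc_of_le hpq] at hl
        have hl' : l ∈ Set.Icc c d := ⟨by linarith [hl.1], by linarith [hl.2]⟩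
        exact norm_mul_exp_le_one (ha0 l hl') (ha1 l hl'))
    rw [one_mul, abs_of_nonneg (by linarith)] at h
    have h1 : z - 1 / √r ≤ p := le_max_right _ _
    have h2 : q ≤ z + 1 / √r := min_le_right _ _
    have h3 : 2 / √r = 1 / √r + 1 / √r := by ring
    linarith
  rw [← intervalIntegral.integral_add_adjacent_intervals (hint c p le_rfl hcp (by linarith))
      (hint p d hcp (by linarith) le_rfl),
    ← intervalIntegral.integral_add_adjacent_intervals
      (hint p q hcp (by linarith) hqd) (hint q d (by linarith) hqd le_rfl)]
  have h12 : 12 / √r = 5 / √r + (2 / √r + 5 / √r) := by ring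
  rw [h12]
  exact (norm_add_le _ _).trans (add_le_add hleft
    ((norm_add_le _ _).trans (add_le_add hmid hright)))

theorem hasDerivAt_sqrt_sq_sub_one {l : ℝ} (hl : 1 < l) :
    HasDerivAt (fun l : ℝ => √(l ^ 2 - 1)) (l / √(l ^ 2 - 1)) l := by
  have h0 : l ^ 2 - 1 ≠ 0 := by nlinarith
  refine (((hasDerivAt_pow 2 l).sub_const 1).sqrt h0).congr_deriv ?_
  norm_num
  ring

theorem hasDerivAt_div_sqrt_sq_sub_one {l : ℝ} (hl : 1 < l) :
    HasDerivAt (fun l : ℝ => l / √(l ^ 2 - 1)) (-(1 / √(l ^ 2 - 1) ^ 3)) l := by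
  have h0 : 0 < l ^ 2 - 1 := by nlinarith
  have hs : 0 < √(l ^ 2 - 1) := Real.sqrt_pos.2 h0
  have hss : √(l ^ 2 - 1) ^ 2 = l ^ 2 - 1 := Real.sq_sqrt h0.le
  refine ((hasDerivAt_id l).div (hasDerivAt_sqrt_sq_sub_one hl) hs.ne').congr_deriv ?_
  simp only [id]
  field_simp
  linarith

theorem hasDerivAt_div_sqrt_add {l : ℝ} (hl : 1 < l) :
    HasDerivAt (fun l : ℝ => l / (√(l ^ 2 - 1) + l))
      (-(1 / (√(l ^ 2 - 1) * (√(l ^ 2 - 1) + l) ^ 2))) l := by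
  have h0 : 0 < l ^ 2 - 1 := by nlinarith
  have hs : 0 < √(l ^ 2 - 1) := Real.sqrt_pos.2 h0
  have hss : √(l ^ 2 - 1) ^ 2 = l ^ 2 - 1 := Real.sq_sqrt h0.le
  refine ((hasDerivAt_id l).div ((hasDerivAt_sqrt_sq_sub_one hl).add (hasDerivAt_id l))
    (by simp only [Pi.add_apply, id]; positivity)).congr_deriv ?_
  simp only [id, Pi.add_apply]
  field_simp
  linarith

theorem div_sqrt_add_nonneg {l : ℝ} (hl : 1 ≤ l) : 0 ≤ l / (√(l ^ 2 - 1) + l) := by positivity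

theorem div_sqrt_add_le_one {l : ℝ} (hl : 1 ≤ l) : l / (√(l ^ 2 - 1) + l) ≤ 1 :=
  div_le_one_of_le₀ (by linarith [Real.sqrt_nonneg (l ^ 2 - 1)]) (by positivity)

theorem hasDerivAt_phase (x y σ : ℝ) {l : ℝ} (hl : 1 < l) :
    HasDerivAt (fun l : ℝ => √(l ^ 2 - 1) * x + l * y + σ * l ^ 2)
      (l / √(l ^ 2 - 1) * x + y + 2 * σ * l) l :=
  ((((hasDerivAt_sqrt_sq_sub_one hl).mul_const x).add ((hasDerivAt_id l).mul_const y)).add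
    ((hasDerivAt_pow 2 l).const_mul σ)).congr_deriv (by norm_num; ring)

theorem hasDerivAt_phase_deriv (x y σ : ℝ) {l : ℝ} (hl : 1 < l) :
    HasDerivAt (fun l : ℝ => l / √(l ^ 2 - 1) * x + y + 2 * σ * l)
      (-(x / √(l ^ 2 - 1) ^ 3) + 2 * σ) l :=
  ((((hasDerivAt_div_sqrt_sq_sub_one hl).mul_const x).add_const y).add
    ((hasDerivAt_id l).const_mul (2 * σ))).congr_deriv (by ring)

theorem norm_integral_le_of_pos {x y t c d : ℝ} (hx : 0 < x) (hy : 0 < y) (ht : 0 < t)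
    (hc : 1 + 1 / √t ≤ c) (hcd : c ≤ d) :
    ‖∫ l in c..d, ((l / (√(l ^ 2 - 1) + l) : ℝ) : ℂ)
      * exp ((√(l ^ 2 - 1) * x + l * y + t * l ^ 2 : ℝ) * I)‖ ≤ 14 / √t := by
  have hs : 0 < √t := Real.sqrt_pos.2 ht
  have hss : √t * √t = t := Real.mul_self_sqrt ht.le
  have h1t : 0 < 1 / √t := by positivity
  have htl : ∀ l ∈ Set.Icc c d, 1 < l ∧ √t ≤ t * l := fun l hl => by
    have h1 : 1 / √t ≤ l := by linarith [hl.1]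
    have h2 : √t * 1 ≤ √t * (√t * l) := by
      refine mul_le_mul_of_nonneg_left ?_ hs.le
      rwa [div_le_iff₀' hs] at h1
    exact ⟨by linarith [hl.1], by rw [← mul_assoc, hss] at h2; linarith⟩
  have h := norm_integral_mul_exp_le_of_le_abs_deriv (m := √t)
    (G := fun l => -(t * l)⁻¹ * 2 + (√t + l / √(l ^ 2 - 1) * x)⁻¹)
    (H := fun l => 2 * t / (t * l) ^ 2
      + x / √(l ^ 2 - 1) ^ 3 / (√t + l / √(l ^ 2 - 1) * x) ^ 2) hcd hs
    (fun l hl => hasDerivAt_div_sqrt_add (htl l hl).1)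
    (fun l hl => div_sqrt_add_nonneg (htl l hl).1.le)
    (fun l hl => div_sqrt_add_le_one (htl l hl).1.le)
    (fun l hl => by
      have := (htl l hl).1
      rw [neg_nonpos]
      positivity)
    (fun l hl => hasDerivAt_phase x y t (htl l hl).1)
    (fun l hl => hasDerivAt_phase_deriv x y t (htl l hl).1)
    (fun l hl => by
      obtain ⟨h1, h2⟩ := htl l hl
      have : 0 ≤ l / √(l ^ 2 - 1) * x := by positivity
      refine le_abs.2 (Or.inl ?_)
      linarith)
    (fun l hl => by
      obtain ⟨h1, h2⟩ := htl l hl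
      have hp : 0 ≤ l / √(l ^ 2 - 1) * x := by positivity
      have ha := ((hasDerivAt_id l).const_mul t).inv (by simp only [id]; positivity)
      have hb := (((hasDerivAt_div_sqrt_sq_sub_one h1).mul_const x).const_add (√t)).inv
        (by positivity)
      refine ((ha.neg.mul_const 2).add hb).congr_deriv ?_
      simp only [id]
      ring)
    (fun l hl => by
      obtain ⟨h1, h2⟩ := htl l hl
      have hp : 0 ≤ l / √(l ^ 2 - 1) * x := by positivity
      have h3 : |-(x / √(l ^ 2 - 1) ^ 3) + 2 * t| ≤ 2 * t + x / √(l ^ 2 - 1) ^ 3 := by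
        have : 0 ≤ x / √(l ^ 2 - 1) ^ 3 := by positivity
        rw [abs_le]
        constructor <;> linarith
      have h4 : 0 < t * l := by positivity
      refine (div_le_div_of_nonneg_right h3 (sq_nonneg _)).trans ?_
      rw [add_div]
      have h5 : t * l ≤ l / √(l ^ 2 - 1) * x + y + 2 * t * l := by linarith
      have h6 : √t + l / √(l ^ 2 - 1) * x ≤ l / √(l ^ 2 - 1) * x + y + 2 * t * l := by linarith
      exact add_le_add
        (div_le_div_of_nonneg_left (by positivity) (by positivity) (pow_le_pow_left₀ h4.le h5 2))
        (div_le_div_of_nonneg_left (by positivity) (by positivity)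
          (pow_le_pow_left₀ (by positivity) h6 2)))
  have hc1 := htl c (Set.left_mem_Icc.2 hcd)
  have hd1 := htl d (Set.right_mem_Icc.2 hcd)
  have e1 : (t * c)⁻¹ ≤ (√t)⁻¹ := inv_anti₀ hs hc1.2
  have e2 : 0 ≤ (t * d)⁻¹ := inv_nonneg.2 (hs.le.trans hd1.2)
  have e3 : (√t + d / √(d ^ 2 - 1) * x)⁻¹ ≤ (√t)⁻¹ := by
    have := hd1.1
    exact inv_anti₀ hs (le_add_of_nonneg_right (by positivity))
  have e4 : 0 ≤ (√t + c / √(c ^ 2 - 1) * x)⁻¹ := by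
    have := hc1.1
    positivity
  have e5 : 0 ≤ (√t)⁻¹ := by positivity
  simp only [div_eq_mul_inv _ (√t)] at h ⊢
  linarith

theorem norm_integral_le_of_neg {x y t c d : ℝ} (hx : 0 < x) (ht : 0 < t)
    (hc : 1 < c) (hcd : c ≤ d) :
    ‖∫ l in c..d, ((l / (√(l ^ 2 - 1) + l) : ℝ) : ℂ)
      * exp ((√(l ^ 2 - 1) * x + l * y + -t * l ^ 2 : ℝ) * I)‖ ≤ 14 / √t := by
  have hl1 : ∀ l ∈ Set.Icc c d, 1 < l := fun l hl => hc.trans_le hl.1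
  have h := norm_integral_mul_exp_le_of_second_deriv_le (r := t) hcd ht
    (fun l hl => hasDerivAt_div_sqrt_add (hl1 l hl))
    (fun l hl => div_sqrt_add_nonneg (hl1 l hl).le)
    (fun l hl => div_sqrt_add_le_one (hl1 l hl).le)
    (fun l hl => by
      have := hl1 l hl
      rw [neg_nonpos]
      positivity)
    (fun l hl => hasDerivAt_phase x y (-t) (hl1 l hl))
    (fun l hl => hasDerivAt_phase_deriv x y (-t) (hl1 l hl))
    (fun l hl => by
      have : 0 ≤ x / √(l ^ 2 - 1) ^ 3 := by positivity
      linarith)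
  refine h.trans ?_
  gcongr
  norm_num

/-- For all `b > 1`, `x, y > 0`, `t ≠ 0` and either sign `s = ±1`,
`|∫_1^b (λ/(√(λ²−1)+λ)) e^{i√(λ²−1)x} e^{iλy} e^{±itλ²} dλ| ≤ 15 |t|^{−1/2}`. -/
theorem stmt1 (b x y t s : ℝ) (hb : 1 < b) (hx : 0 < x) (hy : 0 < y) (ht : t ≠ 0)
    (hs : s = 1 ∨ s = -1) :
    ‖∫ l in Set.Icc (1:ℝ) b,
        ((l : ℂ) / ((Real.sqrt (l ^ 2 - 1) + l : ℝ) : ℂ))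
          * Complex.exp (Complex.I * (Real.sqrt (l ^ 2 - 1) : ℂ) * (x : ℂ))
          * Complex.exp (Complex.I * (l : ℂ) * (y : ℂ))
          * Complex.exp (Complex.I * (s : ℂ) * (t : ℂ) * (l : ℂ) ^ 2)‖
      ≤ 15 * |t| ^ (-(1:ℝ)/2) := by
  have hτ : 0 < |t| := abs_pos.2 ht
  have hsτ : 0 < √|t| := Real.sqrt_pos.2 hτ
  have hpow : |t| ^ (-(1:ℝ)/2) = 1 / √|t| := by
    rw [Real.sqrt_eq_rpow, one_div, ← Real.rpow_neg hτ.le]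
    norm_num
  have hδ : 0 < 1 / √|t| := by positivity
  set f : ℝ → ℂ := fun l => ((l / (√(l ^ 2 - 1) + l) : ℝ) : ℂ)
      * exp ((√(l ^ 2 - 1) * x + l * y + s * t * l ^ 2 : ℝ) * I) with hf
  have hI : (∫ l in Set.Icc (1:ℝ) b,
        ((l : ℂ) / ((Real.sqrt (l ^ 2 - 1) + l : ℝ) : ℂ))
          * Complex.exp (Complex.I * (Real.sqrt (l ^ 2 - 1) : ℂ) * (x : ℂ))
          * Complex.exp (Complex.I * (l : ℂ) * (y : ℂ))
          * Complex.exp (Complex.I * (s : ℂ) * (t : ℂ) * (l : ℂ) ^ 2)) = ∫ l in (1:ℝ)..b, f l := by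
    rw [integral_Icc_eq_integral_Ioc, ← intervalIntegral.integral_of_le hb.le]
    congr 1
    funext l
    rw [hf, mul_assoc, mul_assoc, ← exp_add, ← exp_add]
    push_cast
    ring_nf
  rw [hI, hpow]
  have hfc : ContinuousOn f (Set.Icc 1 b) := by
    have h0 : ∀ l ∈ Set.Icc (1:ℝ) b, √(l ^ 2 - 1) + l ≠ 0 := fun l hl => by
      linarith [hl.1, Real.sqrt_nonneg (l ^ 2 - 1)]
    have h1 : ContinuousOn (fun l : ℝ => l / (√(l ^ 2 - 1) + l)) (Set.Icc 1 b) :=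
      continuousOn_id.div (by fun_prop) h0
    exact (continuous_ofReal.comp_continuousOn h1).mul (by fun_prop)
  have hshort : ∀ c, 1 ≤ c → c ≤ b → c ≤ 1 + 1 / √|t| → ‖∫ l in (1:ℝ)..c, f l‖ ≤ 1 / √|t| := by
    intro c h1 h2 h3
    have h := intervalIntegral.norm_integral_le_of_norm_le_const
      (a := 1) (b := c) (C := 1) (f := f) (fun l hl => by
        rw [Set.uIoc_of_le h1] at hl
        exact norm_mul_exp_le_one (div_sqrt_add_nonneg hl.1.le) (div_sqrt_add_le_one hl.1.le))
    rw [one_mul, abs_of_nonneg (by linarith)] at h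
    linarith
  rcases le_total b (1 + 1 / √|t|) with hbc | hbc
  · linarith [hshort b hb.le le_rfl hbc]
  have hlong : ‖∫ l in (1 + 1 / √|t|)..b, f l‖ ≤ 14 / √|t| := by
    have hst : s * t = |t| ∨ s * t = -|t| := by
      rw [← abs_eq_abs, abs_abs, abs_mul]
      rcases hs with rfl | rfl <;> simp
    rcases hst with h | h <;> simp only [hf, h]
    · exact norm_integral_le_of_pos hx hy hτ le_rfl hbc
    · exact norm_integral_le_of_neg hx hτ (by linarith) hbc
  have hc1 : 1 ≤ 1 + 1 / √|t| := by linarith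
  rw [← intervalIntegral.integral_add_adjacent_intervals
    ((hfc.mono (Set.Icc_subset_Icc_right hbc)).intervalIntegrable_of_Icc hc1)
    ((hfc.mono (Set.Icc_subset_Icc_left hc1)).intervalIntegrable_of_Icc hbc)]
  have h15 : 15 * (1 / √|t|) = 1 / √|t| + 14 / √|t| := by ring
  rw [h15]
  exact (norm_add_le _ _).trans (add_le_add (hshort _ hc1 hbc le_rfl) hlong)
end

section
/- sup_{M > 1} ∫_0^∞ |∫_ℝ (λ/ρ₊(λ)) e^{iρ₊(λ)A} χ(λ/M) dλ| dA < ∞; that is, the function A ↦ ∫_ℝ (λ/ρ₊(λ)) e^{iρ₊(λ)A} χ(λ/M) dλ has L¹((0,∞), dA) norm bounded uniformly in M > 1. -/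
open MeasureTheory Complex

/-- The function `ρ₊(λ)`: `(λ²−1)^{1/2}` for `λ > 1`, `i(1−λ²)^{1/2}` for `−1 ≤ λ ≤ 1`,
`−(λ²−1)^{1/2}` for `λ < −1`. -/
noncomputable def rhoPlus (l : ℝ) : ℂ :=
  if 1 < l then (Real.sqrt (l ^ 2 - 1) : ℂ)
  else if l < -1 then -(Real.sqrt (l ^ 2 - 1) : ℂ)
  else Complex.I * (Real.sqrt (1 - l ^ 2) : ℂ)

lemma hasDerivAt_sqrt_one_add_sq (s : ℝ) :
    HasDerivAt (fun s : ℝ => √(1 + s ^ 2)) (s / √(1 + s ^ 2)) s := by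
  have h : HasDerivAt (fun s : ℝ => 1 + s ^ 2) (2 * s) s := by
    simpa using (hasDerivAt_pow 2 s).const_add 1
  convert h.sqrt (by positivity) using 1
  field_simp

lemma hasDerivAt_div_sqrt_one_add_sq (s : ℝ) :
    HasDerivAt (fun s : ℝ => s / √(1 + s ^ 2)) (1 / √(1 + s ^ 2) ^ 3) s := by
  have hpos : 0 < √(1 + s ^ 2) := by positivity
  have hsq : √(1 + s ^ 2) ^ 2 = 1 + s ^ 2 := Real.sq_sqrt (by positivity)
  refine ((hasDerivAt_id' s).div (hasDerivAt_sqrt_one_add_sq s) hpos.ne').congr_deriv ?_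
  field_simp
  linarith

lemma hasDerivAt_comp_sqrt_div {χ : ℝ → ℝ} (hχ : Differentiable ℝ χ) (M s : ℝ) :
    HasDerivAt (fun s : ℝ => χ (√(1 + s ^ 2) / M))
      (deriv χ (√(1 + s ^ 2) / M) * (s / √(1 + s ^ 2) / M)) s :=
  (hχ _).hasDerivAt.comp s ((hasDerivAt_sqrt_one_add_sq s).div_const M)

lemma hasDerivAt_deriv_comp_sqrt_div {χ : ℝ → ℝ} (hχ : Differentiable ℝ (deriv χ)) (M s : ℝ) :
    HasDerivAt (fun s : ℝ => deriv χ (√(1 + s ^ 2) / M) * (s / √(1 + s ^ 2) / M))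
      (deriv (deriv χ) (√(1 + s ^ 2) / M) * (s / √(1 + s ^ 2) / M) ^ 2 +
        deriv χ (√(1 + s ^ 2) / M) * (1 / √(1 + s ^ 2) ^ 3 / M)) s := by
  refine ((hasDerivAt_comp_sqrt_div hχ M s).mul
    ((hasDerivAt_div_sqrt_one_add_sq s).div_const M)).congr_deriv ?_
  ring

lemma lt_sqrt_one_add_sq_div {R M s : ℝ} (hM : 0 < M) (hs : R * M ≤ |s|) :
    R < √(1 + s ^ 2) / M := by
  rw [lt_div_iff₀ hM]
  refine hs.trans_lt (Real.lt_sqrt_of_sq_lt ?_)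
  rw [sq_abs]
  linarith

lemma integrable_of_eq_zero_of_le_abs {f : ℝ → ℝ} (hf : Continuous f) {R : ℝ}
    (h : ∀ s, R ≤ |s| → f s = 0) : Integrable f := by
  refine hf.integrable_of_hasCompactSupport
    (HasCompactSupport.intro (isCompact_Icc (a := -R) (b := R)) fun s hs => h s ?_)
  by_contra! hlt
  exact hs (abs_le.1 hlt.le)

lemma abs_integral_le_of_eq_zero_of_le_abs {f : ℝ → ℝ} {R K : ℝ} (hR : 0 ≤ R)
    (h : ∀ s, R ≤ |s| → f s = 0) (hK : ∀ s, |f s| ≤ K) : |∫ s, f s| ≤ K * (2 * R) := by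
  have hset : ∫ s in Set.Icc (-R) R, f s = ∫ s, f s :=
    setIntegral_eq_integral_of_forall_compl_eq_zero fun s hs => h s (by
      by_contra! hlt
      exact hs (abs_le.1 hlt.le))
  rw [← hset, ← Real.norm_eq_abs]
  refine (norm_setIntegral_le_of_norm_le_const (by simp) fun s _ => hK s).trans_eq ?_
  rw [Real.volume_real_Icc_of_le (by linarith)]
  ring

lemma sq_mul_integral_cos_mul {f f' f'' : ℝ → ℝ} (hf : ∀ s, HasDerivAt f (f' s) s)
    (hf' : ∀ s, HasDerivAt f' (f'' s) s) (hi : Integrable f) (hi' : Integrable f')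
    (hi'' : Integrable f'') (A : ℝ) :
    A ^ 2 * ∫ s, Real.cos (s * A) * f s = -∫ s, Real.cos (s * A) * f'' s := by
  have hcos {g : ℝ → ℝ} (hg : Integrable g) : Integrable fun s => Real.cos (s * A) * g s :=
    hg.bdd_mul (c := 1) (by fun_prop) (.of_forall fun s => Real.abs_cos_le_one _)
  have hsin {g : ℝ → ℝ} (hg : Integrable g) : Integrable fun s => Real.sin (s * A) * g s :=
    hg.bdd_mul (c := 1) (by fun_prop) (.of_forall fun s => Real.abs_sin_le_one _)
  have dsin (s : ℝ) : HasDerivAt (fun s => Real.sin (s * A)) (Real.cos (s * A) * A) s := by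
    simpa using ((hasDerivAt_id s).mul_const A).sin
  have dcos (s : ℝ) : HasDerivAt (fun s => Real.cos (s * A)) (-Real.sin (s * A) * A) s := by
    simpa using ((hasDerivAt_id s).mul_const A).cos
  have h1 := integral_mul_deriv_eq_deriv_mul_of_integrable (fun s _ => dsin s) (fun s _ => hf s)
    (hsin hi') (by
      refine ((hcos hi).const_mul A).congr (.of_forall fun s => ?_)
      simp only [Pi.mul_apply]
      ring) (hsin hi)
  have h2 := integral_mul_deriv_eq_deriv_mul_of_integrable (fun s _ => dcos s) (fun s _ => hf' s)
    (hcos hi'') (by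
      refine ((hsin hi').const_mul (-A)).congr (.of_forall fun s => ?_)
      simp only [Pi.mul_apply]
      ring) (hcos hi')
  have e1 : ∫ s, Real.cos (s * A) * A * f s = A * ∫ s, Real.cos (s * A) * f s := by
    rw [← integral_const_mul]
    congr with s
    ring
  have e2 : ∫ s, -Real.sin (s * A) * A * f' s = -A * ∫ s, Real.sin (s * A) * f' s := by
    rw [← integral_const_mul]
    congr with s
    ring
  rw [e1] at h1
  rw [e2] at h2
  rw [h2, h1]
  ring

lemma image_sqrt_one_add_sq_Ioi : (fun s : ℝ => √(1 + s ^ 2)) '' Set.Ioi 0 = Set.Ioi 1 := by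
  ext l
  simp only [Set.mem_image, Set.mem_Ioi]
  constructor
  · rintro ⟨s, hs, rfl⟩
    exact Real.lt_sqrt_of_sq_lt (by nlinarith)
  · intro hl
    refine ⟨√(l ^ 2 - 1), Real.sqrt_pos.2 (by nlinarith), ?_⟩
    rw [Real.sq_sqrt (by nlinarith), add_sub_cancel, Real.sqrt_sq (by linarith)]

lemma integral_Ioi_one_eq (g : ℝ → ℝ) :
    ∫ l in Set.Ioi (1 : ℝ), l / √(l ^ 2 - 1) * g l =
      ∫ s in Set.Ioi (0 : ℝ), g (√(1 + s ^ 2)) := by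
  have hinj : Set.InjOn (fun s : ℝ => √(1 + s ^ 2)) (Set.Ioi 0) := by
    intro a ha b hb hab
    have := (Real.sqrt_inj (by positivity) (by positivity)).1 hab
    exact (pow_left_inj₀ (le_of_lt ha) (le_of_lt hb) two_ne_zero).1 (by linarith)
  rw [← image_sqrt_one_add_sq_Ioi, integral_image_eq_integral_abs_deriv_smul measurableSet_Ioi
    (fun s _ => (hasDerivAt_sqrt_one_add_sq s).hasDerivWithinAt) hinj]
  refine setIntegral_congr_fun measurableSet_Ioi fun s hs => ?_
  have hs : 0 < s := hs
  have hpos : 0 < √(1 + s ^ 2) := by positivity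
  simp only [smul_eq_mul]
  rw [Real.sq_sqrt (by positivity), add_sub_cancel_left, Real.sqrt_sq hs.le,
    abs_of_pos (by positivity)]
  field_simp

lemma rhoPlus_of_one_lt {l : ℝ} (hl : 1 < l) : rhoPlus l = (√(l ^ 2 - 1) : ℂ) := if_pos hl

lemma rhoPlus_neg_of_one_lt {l : ℝ} (hl : 1 < l) : rhoPlus (-l) = -(√(l ^ 2 - 1) : ℂ) := by
  rw [rhoPlus, if_neg (by linarith), if_pos (by linarith), neg_sq]

lemma rhoPlus_neg_of_abs_le_one {l : ℝ} (hl : |l| ≤ 1) : rhoPlus (-l) = rhoPlus l := by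
  have := abs_le.1 hl
  simp only [rhoPlus]
  rw [if_neg (by linarith), if_neg (by linarith), if_neg (by linarith), if_neg (by linarith),
    neg_sq]

lemma integrand_add_integrand_neg {ψ : ℝ → ℝ} (hψ : ∀ l, ψ (-l) = ψ l) (A : ℝ) {l : ℝ}
    (hl : 0 < l) :
    ((l : ℂ) / rhoPlus l) * exp (I * rhoPlus l * (A : ℂ)) * (ψ l : ℂ) +
      (((-l : ℝ) : ℂ) / rhoPlus (-l)) * exp (I * rhoPlus (-l) * (A : ℂ)) * (ψ (-l) : ℂ) =
    (((Set.Ioi 1).indicator (fun l => l / √(l ^ 2 - 1) *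
      (2 * (Real.cos (√(l ^ 2 - 1) * A) * ψ l))) l : ℝ) : ℂ) := by
  rw [hψ]
  by_cases h : 1 < l
  · rw [Set.indicator_of_mem (by exact h), rhoPlus_of_one_lt h, rhoPlus_neg_of_one_lt h]
    push_cast
    rw [neg_div_neg_eq, ← mul_assoc (2 : ℂ), Complex.two_cos]
    ring_nf
  · rw [Set.indicator_of_notMem (by exact h),
      rhoPlus_neg_of_abs_le_one (by rw [abs_of_pos hl]; linarith)]
    push_cast
    ring

lemma integral_rhoPlus_eq {ψ : ℝ → ℝ} (hψ : ∀ l, ψ (-l) = ψ l) (A : ℝ)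
    (hi : Integrable fun l : ℝ =>
      ((l : ℂ) / rhoPlus l) * exp (I * rhoPlus l * (A : ℂ)) * (ψ l : ℂ)) :
    ∫ l : ℝ, ((l : ℂ) / rhoPlus l) * exp (I * rhoPlus l * (A : ℂ)) * (ψ l : ℂ) =
      ((∫ s : ℝ, Real.cos (s * A) * ψ (√(1 + s ^ 2)) : ℝ) : ℂ) := by
  have hneg := integral_comp_neg_Ioi (0 : ℝ) fun l : ℝ =>
    ((l : ℂ) / rhoPlus l) * exp (I * rhoPlus l * (A : ℂ)) * (ψ l : ℂ)
  rw [neg_zero] at hneg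
  rw [← intervalIntegral.integral_Iic_add_Ioi (b := 0) hi.integrableOn hi.integrableOn, ← hneg,
    add_comm, ← integral_add hi.integrableOn hi.comp_neg.integrableOn,
    setIntegral_congr_fun measurableSet_Ioi fun l hl => integrand_add_integrand_neg hψ A hl,
    integral_complex_ofReal, setIntegral_indicator measurableSet_Ioi,
    Set.Ioi_inter_Ioi, max_eq_right zero_le_one]
  have heven : ∫ s : ℝ, Real.cos (s * A) * ψ (√(1 + s ^ 2)) =
      2 * ∫ s in Set.Ioi (0 : ℝ), Real.cos (s * A) * ψ (√(1 + s ^ 2)) := by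
    rw [← integral_comp_abs (f := fun s : ℝ => Real.cos (s * A) * ψ (√(1 + s ^ 2)))]
    congr with s
    rcases abs_choice s with h | h <;> simp [h]
  rw [integral_Ioi_one_eq fun l => 2 * (Real.cos (√(l ^ 2 - 1) * A) * ψ l), heven,
    ← integral_const_mul]
  congr 1
  refine setIntegral_congr_fun measurableSet_Ioi fun s hs => ?_
  rw [Real.sq_sqrt (by positivity), add_sub_cancel_left, Real.sqrt_sq (le_of_lt hs)]

lemma abs_second_deriv_comp_sqrt_div_le {χ : ℝ → ℝ} (hχd1 : ∀ l : ℝ, |deriv χ l| ≤ 1)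
    (hχd2 : ∀ l : ℝ, |deriv (deriv χ) l| ≤ 1) (hχone : ∀ l : ℝ, |l| ≤ 4 → χ l = 1)
    {M : ℝ} (hM : 1 < M) (s : ℝ) :
    |deriv (deriv χ) (√(1 + s ^ 2) / M) * (s / √(1 + s ^ 2) / M) ^ 2 +
        deriv χ (√(1 + s ^ 2) / M) * (1 / √(1 + s ^ 2) ^ 3 / M)| ≤ 2 / M ^ 2 := by
  have hM0 : 0 < M := by linarith
  have hh1 : 1 ≤ √(1 + s ^ 2) := Real.one_le_sqrt.2 (by nlinarith [sq_nonneg s])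
  have hsq : √(1 + s ^ 2) ^ 2 = 1 + s ^ 2 := Real.sq_sqrt (by positivity)
  set h := √(1 + s ^ 2)
  have hb1 : |deriv (deriv χ) (h / M) * (s / h / M) ^ 2| ≤ 1 / M ^ 2 := by
    have : (s / h / M) ^ 2 ≤ 1 / M ^ 2 := by
      rw [div_pow, div_pow, hsq]
      gcongr
      rw [div_le_one (by positivity)]
      linarith
    rw [abs_mul, abs_of_nonneg (sq_nonneg (s / h / M)), ← one_mul (1 / M ^ 2)]
    exact mul_le_mul (hχd2 _) this (sq_nonneg _) zero_le_one
  have hb2 : |deriv χ (h / M) * (1 / h ^ 3 / M)| ≤ 1 / M ^ 2 := by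
    by_cases hlt : h / M < 4
    · have : χ =ᶠ[nhds (h / M)] fun _ => 1 := by
        have hpos : 0 < h / M := by positivity
        filter_upwards [Ioo_mem_nhds hpos hlt] with l hl
        exact hχone l (by rw [abs_of_pos hl.1]; exact hl.2.le)
      rw [this.deriv_eq, deriv_const, zero_mul, abs_zero]
      positivity
    · have hMh : M ≤ h := by
        rw [not_lt, le_div_iff₀ hM0] at hlt
        linarith
      have : 1 / h ^ 3 / M ≤ 1 / M ^ 2 := by
        rw [div_div]
        refine one_div_le_one_div_of_le (by positivity) ?_
        have : h ≤ h ^ 3 := le_self_pow₀ hh1 (by norm_num)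
        nlinarith
      rw [abs_mul, abs_of_nonneg (a := 1 / h ^ 3 / M) (by positivity), ← one_mul (1 / M ^ 2)]
      exact mul_le_mul (hχd1 _) this (by positivity) zero_le_one
  calc _ ≤ 1 / M ^ 2 + 1 / M ^ 2 := (abs_add_le _ _).trans (add_le_add hb1 hb2)
    _ = 2 / M ^ 2 := by ring

lemma deriv_eq_zero_of_lt_abs {f : ℝ → ℝ} {R : ℝ} (hf : ∀ l, R < |l| → f l = 0) :
    ∀ l, R < |l| → deriv f l = 0 := by
  intro l hl
  have : f =ᶠ[nhds l] fun _ => 0 := by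
    filter_upwards [(isOpen_lt continuous_const continuous_abs).mem_nhds hl] with x hx
    exact hf x hx
  rw [this.deriv_eq, deriv_const]

lemma abs_integral_cos_mul_le {χ : ℝ → ℝ} (hχs : ContDiff ℝ (⊤ : ℕ∞) χ)
    (hχone : ∀ l : ℝ, |l| ≤ 4 → χ l = 1) (hχzero : ∀ l : ℝ, 8 ≤ |l| → χ l = 0)
    (hχd1 : ∀ l : ℝ, |deriv χ l| ≤ 1) (hχd2 : ∀ l : ℝ, |deriv (deriv χ) l| ≤ 1)
    {B : ℝ} (hB : ∀ l, |χ l| ≤ B) {M : ℝ} (hM : 1 < M) (A : ℝ) :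
    |∫ s : ℝ, Real.cos (s * A) * χ (√(1 + s ^ 2) / M)| ≤
      (16 * B + 32) * M * (1 + (M * A) ^ 2)⁻¹ := by
  have hM0 : 0 < M := by linarith
  have hs1 : ContDiff ℝ (⊤ : ℕ∞) (deriv χ) := (contDiff_infty_iff_deriv.1 hχs).2
  have hs2 : ContDiff ℝ (⊤ : ℕ∞) (deriv (deriv χ)) := (contDiff_infty_iff_deriv.1 hs1).2
  have c0 : Continuous χ := hχs.continuous
  have c1 : Continuous (deriv χ) := hs1.continuous
  have c2 : Continuous (deriv (deriv χ)) := hs2.continuous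
  have hne (s : ℝ) : √(1 + s ^ 2) ≠ 0 := by positivity
  have z0 : ∀ l : ℝ, 8 < |l| → χ l = 0 := fun l hl => hχzero l hl.le
  have z1 := deriv_eq_zero_of_lt_abs z0
  have z2 := deriv_eq_zero_of_lt_abs z1
  have hbig {s : ℝ} (hs : 8 * M ≤ |s|) : 8 < |√(1 + s ^ 2) / M| :=
    (lt_sqrt_one_add_sq_div hM0 hs).trans_le (le_abs_self _)
  have hcos {g : ℝ → ℝ} {K : ℝ} (hg : ∀ s, |g s| ≤ K) (s : ℝ) : |Real.cos (s * A) * g s| ≤ K := by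
    rw [abs_mul]
    exact (mul_le_of_le_one_left (abs_nonneg _) (Real.abs_cos_le_one _)).trans (hg s)
  have hparts := sq_mul_integral_cos_mul
    (hasDerivAt_comp_sqrt_div (hχs.differentiable (by simp)) M)
    (hasDerivAt_deriv_comp_sqrt_div (hs1.differentiable (by simp)) M)
    (integrable_of_eq_zero_of_le_abs (R := 8 * M) (by fun_prop) fun s hs => z0 _ (hbig hs))
    (integrable_of_eq_zero_of_le_abs (R := 8 * M) (by fun_prop (disch := simp))
      fun s hs => by rw [z1 _ (hbig hs), zero_mul])
    (integrable_of_eq_zero_of_le_abs (R := 8 * M) (by fun_prop (disch := simp [hne]))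
      fun s hs => by rw [z1 _ (hbig hs), z2 _ (hbig hs), zero_mul, zero_mul, zero_add]) A
  have hlow : |∫ s : ℝ, Real.cos (s * A) * χ (√(1 + s ^ 2) / M)| ≤ B * (2 * (8 * M)) :=
    abs_integral_le_of_eq_zero_of_le_abs (by positivity)
      (fun s hs => by rw [z0 _ (hbig hs), mul_zero]) (hcos fun s => hB _)
  have hhigh := abs_integral_le_of_eq_zero_of_le_abs (R := 8 * M) (by positivity)
    (fun s hs => by rw [z1 _ (hbig hs), z2 _ (hbig hs), zero_mul, zero_mul, zero_add, mul_zero])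
    (hcos (abs_second_deriv_comp_sqrt_div_le hχd1 hχd2 hχone hM))
  rw [← abs_neg, ← hparts, abs_mul, abs_of_nonneg (sq_nonneg A)] at hhigh
  rw [← div_eq_mul_inv, le_div_iff₀ (by positivity)]
  have hscaled := mul_le_mul_of_nonneg_left hhigh (sq_nonneg M)
  have : M ^ 2 * (2 / M ^ 2 * (2 * (8 * M))) = 32 * M := by
    field_simp
    norm_num
  nlinarith

/-- The `L¹((0,∞), dA)` norm of `A ↦ ∫ (λ/ρ₊(λ)) e^{iρ₊(λ)A} χ(λ/M) dλ` is bounded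
uniformly in `M > 1`. -/
theorem stmt6 (χ : ℝ → ℝ)
    (hχs : ContDiff ℝ (⊤ : ℕ∞) χ) (hχsupp : HasCompactSupport χ) (hχeven : ∀ l : ℝ, χ (-l) = χ l)
    (hχone : ∀ l : ℝ, |l| ≤ 4 → χ l = 1) (hχzero : ∀ l : ℝ, 8 ≤ |l| → χ l = 0)
    (hχd1 : ∀ l : ℝ, |deriv χ l| ≤ 1) (hχd2 : ∀ l : ℝ, |deriv (deriv χ) l| ≤ 1) :
    ∃ C : ℝ, ∀ M : ℝ, 1 < M →
      (∫ A in Set.Ioi (0:ℝ),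
        ‖∫ l : ℝ, ((l : ℂ) / rhoPlus l) * Complex.exp (Complex.I * rhoPlus l * (A : ℂ))
            * (χ (l / M) : ℂ)‖) ≤ C := by
  obtain ⟨B, hB⟩ := hχsupp.exists_bound_of_continuous hχs.continuous
  refine ⟨(16 * B + 32) * (Real.pi / 2), fun M hM => ?_⟩
  have hM0 : 0 < M := by linarith
  have hB0 : 0 ≤ B := (norm_nonneg _).trans (hB 0)
  have hint : Integrable fun A : ℝ => (16 * B + 32) * M * (1 + (M * A) ^ 2)⁻¹ :=
    (integrable_inv_one_add_sq.comp_mul_left' hM0.ne').const_mul _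
  calc _ ≤ ∫ A in Set.Ioi (0 : ℝ), (16 * B + 32) * M * (1 + (M * A) ^ 2)⁻¹ := by
        refine integral_mono_of_nonneg (.of_forall fun A => norm_nonneg _) hint.integrableOn
          (.of_forall fun A => ?_)
        simp only
        by_cases hi : Integrable fun l : ℝ =>
            ((l : ℂ) / rhoPlus l) * exp (I * rhoPlus l * (A : ℂ)) * (χ (l / M) : ℂ)
        · rw [integral_rhoPlus_eq (ψ := fun l => χ (l / M))
            (fun l => by rw [neg_div, hχeven]) A hi, norm_real, Real.norm_eq_abs]
          exact abs_integral_cos_mul_le hχs hχone hχzero hχd1 hχd2 hB hM A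
        · rw [integral_undef hi, norm_zero]
          positivity
    _ = (16 * B + 32) * (Real.pi / 2) := by
        rw [integral_const_mul, integral_comp_mul_left_Ioi (fun x => (1 + x ^ 2)⁻¹) 0 hM0,
          mul_zero, integral_Ioi_inv_one_add_sq, Real.arctan_zero, sub_zero, smul_eq_mul]
        field_simp
end
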